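/- For any full binary group-identification tree T (leaves labeled by disjoint nonempty pure subsets partitioning Θ), the expected number of queries to identify the group satisfies Σ_{j ∈ leaves} π_{Θ_j} d_j ≥ H(Π_y), and equality holds if and only if at every internal node a the reduction factor ρ_a equals 1/2 and the group reduction factor ρ_a^i equals 1 for every group i with π_{Θ_a^i} > 0. -/

import Mathlib

/-- A full binary tree with leaves labeled by elements of `σ`. For group
identification, leaves are labeled by subsets of the object set. -/
inductive BTree (σ : Type) : Type where
  | leaf : σ → BTree σ
  | node : BTree σ → BTree σ → BTree σ

namespace BTree

variable {σ : Type}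

/-- The list of leaf labels of a tree. -/
def leaves : BTree σ → List σ
  | .leaf a => [a]
  | .node l r => leaves l ++ leaves r

/-- The list of leaf labels together with their depths (root has depth 0). -/
def leavesD : BTree σ → List (σ × ℕ)
  | .leaf a => [(a, 0)]
  | .node l r => (leavesD l ++ leavesD r).map fun p => (p.1, p.2 + 1)

/-- The list of internal nodes (as subtrees) together with their depths. -/
def internals : BTree σ → List (BTree σ × ℕ)
  | .leaf _ => []
  | .node l r => (.node l r, 0) :: ((internals l ++ internals r).map fun p => (p.1, p.2 + 1))

/-- Left child (identity on leaves). -/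
def left : BTree σ → BTree σ
  | .leaf a => .leaf a
  | .node l _ => l

/-- Right child (identity on leaves). -/
def right : BTree σ → BTree σ
  | .leaf a => .leaf a
  | .node _ r => r

variable {ι : Type} [DecidableEq ι]

/-- `objs t` is the set `Θ_a` of objects at the leaves of the subtree `t`. -/
def objs : BTree (Finset ι) → Finset ι
  | .leaf S => S
  | .node l r => objs l ∪ objs r

end BTree

variable {ι : Type} [DecidableEq ι] {m : ℕ}

/-- `π_{Θ_a}`, the total weight of the objects at the node rooting `t`. -/
noncomputable def gmass (π : ι → ℝ) (t : BTree (Finset ι)) : ℝ := ∑ k ∈ t.objs, π k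

/-- `π_{Θ_a^i}`, the total weight of group-`i` objects at the node rooting `t`. -/
noncomputable def gmassGroup (π : ι → ℝ) (y : ι → Fin m) (i : Fin m)
    (t : BTree (Finset ι)) : ℝ :=
  ∑ k ∈ t.objs.filter (fun k => y k = i), π k

/-- The reduction factor `ρ_a = max(π_{Θ_{l(a)}}, π_{Θ_{r(a)}})/π_{Θ_a}` at the node
rooting the subtree `t`. -/
noncomputable def redFactor (π : ι → ℝ) (t : BTree (Finset ι)) : ℝ :=
  max (gmass π t.left) (gmass π t.right) / gmass π t

/-- The group reduction factor `ρ_a^i = max(π_{Θ^i_{l(a)}}, π_{Θ^i_{r(a)}})/π_{Θ_a^i}`. -/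
noncomputable def groupRedFactor (π : ι → ℝ) (y : ι → Fin m) (i : Fin m)
    (t : BTree (Finset ι)) : ℝ :=
  max (gmassGroup π y i t.left) (gmassGroup π y i t.right) / gmassGroup π y i t

open Real (log logb log_lt_log log_div log_pos negMulLog negMulLog_zero negMulLog_one
  strictConcaveOn_negMulLog)

/-- The expected leaf depth of `t`, weighted by the (unnormalized) leaf masses. -/
noncomputable def leafCost (π : ι → ℝ) (t : BTree (Finset ι)) : ℝ :=
  (t.leavesD.map fun p => (∑ k ∈ p.1, π k) * (p.2 : ℝ)).sum

/-- The unnormalized group entropy, in nats, of the objects below the root of `t`. -/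
noncomputable def groupEntropy (π : ι → ℝ) (y : ι → Fin m) (t : BTree (Finset ι)) : ℝ :=
  ∑ i, negMulLog (gmassGroup π y i t) - negMulLog (gmass π t)

/-- The balance condition at the root of `t`. -/
def IsBalanced (π : ι → ℝ) (y : ι → Fin m) (t : BTree (Finset ι)) : Prop :=
  redFactor π t = 1 / 2 ∧
    ∀ i : Fin m, 0 < gmassGroup π y i t → groupRedFactor π y i t = 1

theorem negMulLog_add_le {a b : ℝ} (ha : 0 ≤ a) (hb : 0 ≤ b) :
    negMulLog (a + b) ≤ negMulLog a + negMulLog b ∧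
      (negMulLog (a + b) = negMulLog a + negMulLog b ↔ a = 0 ∨ b = 0) := by
  rcases ha.eq_or_lt with rfl | ha
  · simp
  rcases hb.eq_or_lt with rfl | hb
  · simp
  have h1 : a * log a < a * log (a + b) :=
    mul_lt_mul_of_pos_left (log_lt_log ha (by linarith)) ha
  have h2 : b * log b < b * log (a + b) :=
    mul_lt_mul_of_pos_left (log_lt_log hb (by linarith)) hb
  have h3 : negMulLog (a + b) < negMulLog a + negMulLog b := by
    simp only [negMulLog]
    linarith
  exact ⟨h3.le, fun h => absurd h h3.ne, fun h => by rcases h with h | h <;> linarith⟩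

theorem add_negMulLog_le_log_two_mul {a b : ℝ} (ha : 0 ≤ a) (hb : 0 ≤ b) (hab : 0 < a + b) :
    negMulLog a + negMulLog b ≤ log 2 * (a + b) + negMulLog (a + b) ∧
      (negMulLog a + negMulLog b = log 2 * (a + b) + negMulLog (a + b) ↔ a = b) := by
  have key : log 2 * (a + b) + negMulLog (a + b) = 2 * negMulLog ((a + b) / 2) := by
    simp only [negMulLog, log_div hab.ne' two_ne_zero]
    ring
  rw [key]
  by_cases h : a = b
  · subst h
    rw [show (a + a) / 2 = a by ring]
    constructor
    · linarith
    · simp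
      ring
  · have hs := strictConcaveOn_negMulLog.2 (Set.mem_Ici.2 ha) (Set.mem_Ici.2 hb) h
      (by norm_num : (0 : ℝ) < 1 / 2) (by norm_num : (0 : ℝ) < 1 / 2) (by norm_num)
    simp only [smul_eq_mul] at hs
    rw [show 1 / 2 * a + 1 / 2 * b = (a + b) / 2 by ring] at hs
    exact ⟨by linarith, fun h' => by linarith, fun h' => absurd h' h⟩

theorem max_div_add_eq_half_iff {a b : ℝ} (hab : 0 < a + b) :
    max a b / (a + b) = 1 / 2 ↔ a = b := by
  rw [div_eq_iff hab.ne']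
  rcases le_total a b with h | h
  · rw [max_eq_right h]
    constructor <;> intro <;> linarith
  · rw [max_eq_left h]
    constructor <;> intro <;> linarith

theorem max_div_add_eq_one_iff {a b : ℝ} (ha : 0 ≤ a) (hb : 0 ≤ b) :
    (0 < a + b → max a b / (a + b) = 1) ↔ a = 0 ∨ b = 0 := by
  constructor
  · intro H
    rcases (add_nonneg ha hb).eq_or_lt with h | h
    · left; linarith
    · have := H h
      rw [div_eq_iff h.ne'] at this
      rcases le_total a b with h' | h'
      · rw [max_eq_right h'] at this
        left; linarith
      · rw [max_eq_left h'] at this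
        right; linarith
  · rintro (rfl | rfl) h
    · rw [max_eq_right hb, zero_add, div_self (by linarith)]
    · rw [max_eq_left ha, add_zero, div_self (by linarith)]

theorem BTree.disjoint_objs_right {S : Finset ι} {t : BTree (Finset ι)}
    (h : ∀ S' ∈ t.leaves, Disjoint S S') : Disjoint S t.objs := by
  induction t with
  | leaf S' => exact h S' (by simp [BTree.leaves])
  | node l r ihl ihr =>
    simp only [BTree.leaves, List.mem_append] at h
    exact Finset.disjoint_union_right.2
      ⟨ihl fun S' hS' => h S' (.inl hS'), ihr fun S' hS' => h S' (.inr hS')⟩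

theorem BTree.disjoint_objs {s t : BTree (Finset ι)}
    (h : ∀ S ∈ s.leaves, ∀ S' ∈ t.leaves, Disjoint S S') : Disjoint s.objs t.objs :=
  disjoint_objs_right fun S' hS' =>
    (disjoint_objs_right fun S hS => (h S hS S' hS').symm).symm

theorem BTree.objs_nonempty {t : BTree (Finset ι)} (h : ∀ S ∈ t.leaves, S.Nonempty) :
    t.objs.Nonempty := by
  induction t with
  | leaf S => exact h S (by simp [BTree.leaves])
  | node l r ihl _ =>
    exact (ihl fun S hS => h S (by simp [BTree.leaves, hS])).mono Finset.subset_union_left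

theorem gmass_node {π : ι → ℝ} {l r : BTree (Finset ι)} (h : Disjoint l.objs r.objs) :
    gmass π (.node l r) = gmass π l + gmass π r :=
  Finset.sum_union h

theorem gmassGroup_node {π : ι → ℝ} {y : ι → Fin m} {i : Fin m} {l r : BTree (Finset ι)}
    (h : Disjoint l.objs r.objs) :
    gmassGroup π y i (.node l r) = gmassGroup π y i l + gmassGroup π y i r := by
  simp only [gmassGroup, BTree.objs, Finset.filter_union]
  exact Finset.sum_union (Finset.disjoint_filter_filter h)

theorem gmassGroup_nonneg {π : ι → ℝ} (hπ : ∀ k, 0 < π k) (y : ι → Fin m) (i : Fin m)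
    (t : BTree (Finset ι)) : 0 ≤ gmassGroup π y i t :=
  Finset.sum_nonneg fun k _ => (hπ k).le

theorem gmass_pos {π : ι → ℝ} (hπ : ∀ k, 0 < π k) {t : BTree (Finset ι)}
    (h : ∀ S ∈ t.leaves, S.Nonempty) : 0 < gmass π t :=
  Finset.sum_pos (fun k _ => hπ k) (BTree.objs_nonempty h)

theorem sum_map_mul_succ {α : Type} (f : α → ℝ) (L : List (α × ℕ)) :
    ((L.map fun p => (p.1, p.2 + 1)).map fun p : α × ℕ => f p.1 * (p.2 : ℝ)).sum =
      (L.map fun p => f p.1 * (p.2 : ℝ)).sum + (L.map fun p => f p.1).sum := by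
  induction L with
  | nil => simp
  | cons p L ih =>
    simp only [List.map_cons, List.sum_cons, ih]
    push_cast
    ring

theorem BTree.map_fst_leavesD {σ : Type} (t : BTree σ) : t.leavesD.map Prod.fst = t.leaves := by
  induction t with
  | leaf S => rfl
  | node l r ihl ihr =>
    rw [BTree.leavesD, BTree.leaves, ← ihl, ← ihr, List.map_map, ← List.map_append]
    rfl

theorem sum_leaves_eq_gmass (π : ι → ℝ) {t : BTree (Finset ι)}
    (h : t.leaves.Pairwise Disjoint) :
    (t.leaves.map fun S => ∑ k ∈ S, π k).sum = gmass π t := by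
  induction t with
  | leaf S => simp [BTree.leaves, gmass, BTree.objs]
  | node l r ihl ihr =>
    rw [BTree.leaves, List.pairwise_append] at h
    rw [gmass_node (BTree.disjoint_objs h.2.2), BTree.leaves, List.map_append, List.sum_append,
      ihl h.1, ihr h.2.1]

theorem leafCost_node (π : ι → ℝ) {l r : BTree (Finset ι)}
    (h : (BTree.node l r).leaves.Pairwise Disjoint) :
    leafCost π (.node l r) = leafCost π l + leafCost π r + gmass π (.node l r) := by
  have hfst : ((l.leavesD ++ r.leavesD).map fun p => ∑ k ∈ p.1, π k) =
      (BTree.node l r).leaves.map fun S => ∑ k ∈ S, π k := by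
    rw [BTree.leaves, ← BTree.map_fst_leavesD, ← BTree.map_fst_leavesD, ← List.map_append,
      List.map_map]
    rfl
  rw [leafCost, BTree.leavesD, sum_map_mul_succ (fun S : Finset ι => ∑ k ∈ S, π k), hfst,
    sum_leaves_eq_gmass π h, List.map_append, List.sum_append]
  rfl

theorem groupEntropy_leaf {π : ι → ℝ} {y : ι → Fin m} {S : Finset ι} (hS : S.Nonempty)
    (hpure : ∀ k ∈ S, ∀ k' ∈ S, y k = y k') : groupEntropy π y (.leaf S) = 0 := by
  obtain ⟨k₀, hk₀⟩ := hS
  have hgroup : gmassGroup π y (y k₀) (.leaf S) = gmass π (.leaf S) := by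
    rw [gmassGroup, gmass, BTree.objs, Finset.filter_true_of_mem fun k hk => hpure k hk k₀ hk₀]
  rw [groupEntropy, Finset.sum_eq_single (y k₀), hgroup, sub_self]
  · intro i _ hi
    rw [gmassGroup, BTree.objs, Finset.filter_false_of_mem, Finset.sum_empty, negMulLog_zero]
    intro k hk h
    exact hi (h ▸ hpure k hk k₀ hk₀)
  · simp

theorem groupEntropy_node_le {π : ι → ℝ} (hπ : ∀ k, 0 < π k) (y : ι → Fin m)
    {l r : BTree (Finset ι)} (hl : ∀ S ∈ l.leaves, S.Nonempty)
    (hr : ∀ S ∈ r.leaves, S.Nonempty) (h : Disjoint l.objs r.objs) :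
    groupEntropy π y (.node l r) ≤
        groupEntropy π y l + groupEntropy π y r + log 2 * gmass π (.node l r) ∧
      (groupEntropy π y (.node l r) =
          groupEntropy π y l + groupEntropy π y r + log 2 * gmass π (.node l r) ↔
        IsBalanced π y (.node l r)) := by
  have hA := gmass_pos hπ hl
  have hB := gmass_pos hπ hr
  obtain ⟨hroot, hroot_eq⟩ := add_negMulLog_le_log_two_mul hA.le hB.le (add_pos hA hB)
  have hgroup i := negMulLog_add_le (gmassGroup_nonneg hπ y i l) (gmassGroup_nonneg hπ y i r)
  have hsum := Finset.sum_le_sum fun i (_ : i ∈ Finset.univ) => (hgroup i).1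
  have hsum_eq := Finset.sum_eq_sum_iff_of_le fun i (_ : i ∈ Finset.univ) => (hgroup i).1
  have hbal : IsBalanced π y (.node l r) ↔ gmass π l = gmass π r ∧
      ∀ i, gmassGroup π y i l = 0 ∨ gmassGroup π y i r = 0 := by
    simp only [IsBalanced, redFactor, groupRedFactor, BTree.left, BTree.right, gmass_node h,
      gmassGroup_node h, max_div_add_eq_half_iff (add_pos hA hB),
      max_div_add_eq_one_iff (gmassGroup_nonneg hπ y _ l) (gmassGroup_nonneg hπ y _ r)]
  simp only [Finset.mem_univ, forall_const, fun i => (hgroup i).2] at hsum_eq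
  rw [hbal, ← hroot_eq, ← hsum_eq]
  simp only [groupEntropy, gmass_node h, gmassGroup_node h]
  simp only [Finset.sum_add_distrib] at hsum ⊢
  refine ⟨by linarith, fun heq => ⟨by linarith, by linarith⟩, fun ⟨h1, h2⟩ => by linarith⟩

theorem BTree.forall_internals_node {σ : Type} {P : BTree σ → Prop} {l r : BTree σ} :
    (∀ p ∈ (BTree.node l r).internals, P p.1) ↔
      P (.node l r) ∧ (∀ p ∈ l.internals, P p.1) ∧ ∀ p ∈ r.internals, P p.1 := by
  simp only [BTree.internals, List.forall_mem_cons, List.forall_mem_map, List.forall_mem_append]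

theorem groupEntropy_le_leafCost {π : ι → ℝ} (hπ : ∀ k, 0 < π k) (y : ι → Fin m)
    {t : BTree (Finset ι)} (hne : ∀ S ∈ t.leaves, S.Nonempty)
    (hdisj : t.leaves.Pairwise Disjoint)
    (hpure : ∀ S ∈ t.leaves, ∀ k ∈ S, ∀ k' ∈ S, y k = y k') :
    groupEntropy π y t ≤ log 2 * leafCost π t ∧
      (groupEntropy π y t = log 2 * leafCost π t ↔
        ∀ p ∈ t.internals, IsBalanced π y p.1) := by
  induction t with
  | leaf S =>
    have hS : S ∈ (BTree.leaf S).leaves := by simp [BTree.leaves]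
    rw [groupEntropy_leaf (hne S hS) (hpure S hS)]
    simp [leafCost, BTree.leavesD, BTree.internals]
  | node l r ihl ihr =>
    rw [BTree.forall_internals_node, leafCost_node π hdisj]
    rw [BTree.leaves, List.pairwise_append] at hdisj
    simp only [BTree.leaves, List.forall_mem_append] at hne hpure
    obtain ⟨hl, hl_eq⟩ := ihl hne.1 hdisj.1 hpure.1
    obtain ⟨hr, hr_eq⟩ := ihr hne.2 hdisj.2.1 hpure.2
    obtain ⟨hn, hn_eq⟩ :=
      groupEntropy_node_le hπ y hne.1 hne.2 (BTree.disjoint_objs hdisj.2.2)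
    rw [← hl_eq, ← hr_eq, ← hn_eq]
    simp only [mul_add]
    exact ⟨by linarith, fun h => ⟨by linarith, by linarith, by linarith⟩,
      fun ⟨h1, h2, h3⟩ => by linarith⟩

/-- **Corollary (group entropy bound with equality condition).** The expected number of
queries to identify the group is at least the Shannon entropy `H(Π_y)` of the group
distribution, with equality iff at every internal node the reduction factor is `1/2` and
every present group has group reduction factor `1`. -/
theorem group_expected_depth_ge_entropy_iff {ι : Type} [Fintype ι] [DecidableEq ι] {m : ℕ}
    (π : ι → ℝ) (hπ : ∀ k, 0 < π k) (hsum : ∑ k, π k = 1) (y : ι → Fin m)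
    (T : BTree (Finset ι))
    (hne : ∀ S ∈ T.leaves, S.Nonempty)
    (hdisj : T.leaves.Pairwise Disjoint)
    (hunion : T.objs = Finset.univ)
    (hpure : ∀ S ∈ T.leaves, ∀ k ∈ S, ∀ k' ∈ S, y k = y k') :
    (- ∑ i : Fin m, (∑ k ∈ Finset.univ.filter (fun k => y k = i), π k) *
          Real.logb 2 (∑ k ∈ Finset.univ.filter (fun k => y k = i), π k))
      ≤ (T.leavesD.map fun p => (∑ k ∈ p.1, π k) * (p.2 : ℝ)).sum
    ∧ ((T.leavesD.map fun p => (∑ k ∈ p.1, π k) * (p.2 : ℝ)).sum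
          = (- ∑ i : Fin m, (∑ k ∈ Finset.univ.filter (fun k => y k = i), π k) *
              Real.logb 2 (∑ k ∈ Finset.univ.filter (fun k => y k = i), π k))
        ↔ ∀ p ∈ T.internals, redFactor π p.1 = 1 / 2
            ∧ ∀ i : Fin m, 0 < gmassGroup π y i p.1 → groupRedFactor π y i p.1 = 1) := by
  have hlog : 0 < log 2 := log_pos one_lt_two
  have hmass : gmass π T = 1 := by rw [gmass, hunion, hsum]
  have hent : groupEntropy π y T =
      log 2 * (- ∑ i : Fin m, (∑ k ∈ Finset.univ.filter (fun k => y k = i), π k) *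
          Real.logb 2 (∑ k ∈ Finset.univ.filter (fun k => y k = i), π k)) := by
    rw [groupEntropy, hmass, negMulLog_one, sub_zero, mul_neg, Finset.mul_sum,
      ← Finset.sum_neg_distrib]
    refine Finset.sum_congr rfl fun i _ => ?_
    rw [gmassGroup, hunion, negMulLog, logb]
    field_simp
  obtain ⟨hle, heq⟩ := groupEntropy_le_leafCost hπ y hne hdisj hpure
  rw [hent] at hle heq
  refine ⟨le_of_mul_le_mul_left hle hlog, ?_⟩
  rw [mul_right_inj' hlog.ne', eq_comm] at heq
  exact heq
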